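/- arXiv:2011.04125 — 9 statements merged into one kernel-verified Lean document; each statement's English description precedes it below -/
import Mathlib

section
/- Sampling rows of A with probability proportional to their squared Euclidean lengths is within a ratio of κ(A)² of leverage-score sampling: for every row index i ∈ {1,…,n}, (1/κ²)·(τ_i/k) ≤ ‖A_{i,*}‖²/‖A‖_F² ≤ κ²·(τ_i/k), where τ_i = ‖U_{i,*}‖² is the i-th leverage score of A and κ = σ_1/σ_k is the condition number of A. -/
open Matrix BigOperators

/-- The squared length of a row of `U * diagonal σ * Vᵀ` when `V` has orthonormal columns. -/
theorem sum_sq_row_mul_diagonal_mul_transpose {m n k : Type*} [Fintype n] [Fintype k]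
    [DecidableEq k] (U : Matrix m k ℝ) (V : Matrix n k ℝ) (σ : k → ℝ) (hV : Vᵀ * V = 1) (i : m) :
    ∑ j, ((U * diagonal σ * Vᵀ) i j) ^ 2 = ∑ l, σ l ^ 2 * U i l ^ 2 := by
  have hmul : (U * diagonal σ * Vᵀ) * (U * diagonal σ * Vᵀ)ᵀ
      = (U * diagonal σ) * (U * diagonal σ)ᵀ := by
    rw [transpose_mul, transpose_transpose, Matrix.mul_assoc, ← Matrix.mul_assoc Vᵀ, hV,
      Matrix.one_mul]
  have hdiag := congrFun (congrFun hmul i) i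
  rw [Matrix.mul_apply, Matrix.mul_apply] at hdiag
  simp only [transpose_apply, ← sq] at hdiag
  rw [hdiag]
  simp only [mul_diagonal, mul_pow, mul_comm]

/-- The squared Frobenius norm of `U * diagonal σ * Vᵀ` when `U` and `V` have orthonormal
columns. -/
theorem sum_sum_sq_mul_diagonal_mul_transpose {m n k : Type*} [Fintype m] [Fintype n] [Fintype k]
    [DecidableEq k] (U : Matrix m k ℝ) (V : Matrix n k ℝ) (σ : k → ℝ) (hU : Uᵀ * U = 1)
    (hV : Vᵀ * V = 1) :
    ∑ i, ∑ j, ((U * diagonal σ * Vᵀ) i j) ^ 2 = ∑ l, σ l ^ 2 := by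
  simp only [sum_sq_row_mul_diagonal_mul_transpose U V σ hV]
  rw [Finset.sum_comm]
  refine Finset.sum_congr rfl fun l _ => ?_
  have hcol := congrFun (congrFun hU l) l
  simp only [Matrix.mul_apply, transpose_apply, ← sq, one_apply_eq] at hcol
  rw [← Finset.mul_sum, hcol, mul_one]

/-- Length-squared sampling probabilities are within a factor
`κ(A)²` of leverage-score sampling probabilities: for each row `i`,
`(1/κ²)·(τ_i/k) ≤ ‖A_{i,*}‖²/‖A‖_F² ≤ κ²·(τ_i/k)`, where `τ_i = ‖U_{i,*}‖²`
and `κ = σ_1/σ_k`. -/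
theorem length_squared_vs_leverage_scores
    {n d k : ℕ} (hk : 0 < k)
    (A : Matrix (Fin n) (Fin d) ℝ) (U : Matrix (Fin n) (Fin k) ℝ)
    (V : Matrix (Fin d) (Fin k) ℝ) (σ : Fin k → ℝ)
    (hA : A = U * Matrix.diagonal σ * Vᵀ)
    (hU : Uᵀ * U = 1) (hV : Vᵀ * V = 1)
    (hσpos : ∀ i, 0 < σ i)
    (hσmono : ∀ i j : Fin k, i ≤ j → σ j ≤ σ i)
    (i : Fin n) :
    (1 / (σ ⟨0, hk⟩ / σ ⟨k - 1, Nat.sub_lt hk Nat.one_pos⟩) ^ 2)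
        * ((∑ j, (U i j) ^ 2) / (k : ℝ))
      ≤ (∑ j, (A i j) ^ 2) / (∑ i', ∑ j, (A i' j) ^ 2) ∧
    (∑ j, (A i j) ^ 2) / (∑ i', ∑ j, (A i' j) ^ 2)
      ≤ (σ ⟨0, hk⟩ / σ ⟨k - 1, Nat.sub_lt hk Nat.one_pos⟩) ^ 2
        * ((∑ j, (U i j) ^ 2) / (k : ℝ)) := by
  subst hA
  rw [sum_sum_sq_mul_diagonal_mul_transpose U V σ hU hV,
    sum_sq_row_mul_diagonal_mul_transpose U V σ hV i]
  set S := σ ⟨0, hk⟩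
  set s := σ ⟨k - 1, Nat.sub_lt hk Nat.one_pos⟩
  have hS : 0 < S := hσpos _
  have hs : 0 < s := hσpos _
  have hk' : (0 : ℝ) < k := Nat.cast_pos.mpr hk
  have hle (l : Fin k) : σ l ^ 2 ≤ S ^ 2 :=
    pow_le_pow_left₀ (hσpos l).le (hσmono _ _ (Fin.mk_le_of_le_val (Nat.zero_le _))) 2
  have hge (l : Fin k) : s ^ 2 ≤ σ l ^ 2 :=
    pow_le_pow_left₀ hs.le (hσmono _ _ (Fin.le_def.mpr (Nat.le_sub_one_of_lt l.isLt))) 2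
  have hτ : 0 ≤ ∑ j, U i j ^ 2 := Finset.sum_nonneg fun j _ => sq_nonneg _
  have hrow_le : ∑ l, σ l ^ 2 * U i l ^ 2 ≤ S ^ 2 * ∑ j, U i j ^ 2 := by
    rw [Finset.mul_sum]
    exact Finset.sum_le_sum fun l _ => mul_le_mul_of_nonneg_right (hle l) (sq_nonneg _)
  have hrow_ge : s ^ 2 * ∑ j, U i j ^ 2 ≤ ∑ l, σ l ^ 2 * U i l ^ 2 := by
    rw [Finset.mul_sum]
    exact Finset.sum_le_sum fun l _ => mul_le_mul_of_nonneg_right (hge l) (sq_nonneg _)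
  have hfrob_le : ∑ l, σ l ^ 2 ≤ k * S ^ 2 := by
    simpa using Finset.sum_le_sum fun l (_ : l ∈ Finset.univ) => hle l
  have hfrob_ge : k * s ^ 2 ≤ ∑ l, σ l ^ 2 := by
    simpa using Finset.sum_le_sum fun l (_ : l ∈ Finset.univ) => hge l
  have hfrob_pos : 0 < ∑ l, σ l ^ 2 := lt_of_lt_of_le (by positivity) hfrob_ge
  constructor
  · calc 1 / (S / s) ^ 2 * ((∑ j, U i j ^ 2) / k)
        = (s ^ 2 * ∑ j, U i j ^ 2) / (k * S ^ 2) := by field_simp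
      _ ≤ _ := div_le_div₀ ((mul_nonneg (sq_nonneg s) hτ).trans hrow_ge) hrow_ge hfrob_pos hfrob_le
  · calc _ ≤ (S ^ 2 * ∑ j, U i j ^ 2) / (k * s ^ 2) :=
          div_le_div₀ (mul_nonneg (sq_nonneg S) hτ) hrow_le (by positivity) hfrob_ge
      _ = (S / s) ^ 2 * ((∑ j, U i j ^ 2) / k) := by field_simp
end

section
/- The block matrix Û ∈ ℝ^{(n+d)×k} obtained by stacking U Σ D on top of √λ·V D has orthonormal columns (Ûᵀ Û = I_k), and A_λ factors as A_λ = Û D^{−1} Vᵀ; in particular this is a thin singular value decomposition of A_λ with singular values √(σ_i² + λ) for i = 1,…,k. -/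
open Matrix BigOperators

/-- With `D = (Σ² + λI)^{-1/2}`, the block matrix `Û` obtained
by stacking `UΣD` on top of `√λ·VD` has orthonormal columns, and
`A_λ = Û D⁻¹ Vᵀ`, where `D⁻¹ = diag(√(σ_i² + λ))`; together with `VᵀV = I`
this is a thin SVD of `A_λ` with singular values `√(σ_i² + λ)`. -/
theorem augmented_matrix_svd
    {n d k : ℕ} (hk : 0 < k)
    (A : Matrix (Fin n) (Fin d) ℝ) (U : Matrix (Fin n) (Fin k) ℝ)
    (V : Matrix (Fin d) (Fin k) ℝ) (σ : Fin k → ℝ)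
    (lam : ℝ) (hlam : 0 < lam)
    (hA : A = U * Matrix.diagonal σ * Vᵀ)
    (hU : Uᵀ * U = 1) (hV : Vᵀ * V = 1)
    (hσpos : ∀ i, 0 < σ i)
    (hσmono : ∀ i j : Fin k, i ≤ j → σ j ≤ σ i)
    (D : Matrix (Fin k) (Fin k) ℝ)
    (hD : D = Matrix.diagonal (fun i => (Real.sqrt ((σ i) ^ 2 + lam))⁻¹))
    (Uhat : Matrix (Fin n ⊕ Fin d) (Fin k) ℝ)
    (hUhat : Uhat = Matrix.fromRows (U * Matrix.diagonal σ * D)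
        (Real.sqrt lam • (V * D))) :
    Uhatᵀ * Uhat = 1 ∧
    Matrix.fromRows A (Real.sqrt lam • (V * Vᵀ)) = Uhat * D⁻¹ * Vᵀ ∧
    D⁻¹ = Matrix.diagonal (fun i => Real.sqrt ((σ i) ^ 2 + lam)) := by
  have hpos : ∀ i, 0 < σ i ^ 2 + lam := fun i => by positivity
  have hne : ∀ i, Real.sqrt (σ i ^ 2 + lam) ≠ 0 := fun i => (Real.sqrt_pos.2 (hpos i)).ne'
  have hDE : D * Matrix.diagonal (fun i => Real.sqrt (σ i ^ 2 + lam)) = 1 := by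
    rw [hD, diagonal_mul_diagonal, ← diagonal_one]
    congr 1
    funext i
    exact inv_mul_cancel₀ (hne i)
  have hDinv : D⁻¹ = Matrix.diagonal (fun i => Real.sqrt (σ i ^ 2 + lam)) :=
    Matrix.inv_eq_right_inv hDE
  have hDD : D * D⁻¹ = 1 := by rw [hDinv, hDE]
  refine ⟨?_, ?_, hDinv⟩
  · have hDt : Dᵀ = D := by rw [hD, diagonal_transpose]
    have hleft : (U * Matrix.diagonal σ * D)ᵀ * (U * Matrix.diagonal σ * D)
        = D * Matrix.diagonal σ * (Uᵀ * U) * Matrix.diagonal σ * D := by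
      simp only [transpose_mul, diagonal_transpose, hDt, Matrix.mul_assoc]
    have hright : (V * D)ᵀ * (V * D) = D * (Vᵀ * V) * D := by
      simp only [transpose_mul, hDt, Matrix.mul_assoc]
    rw [hUhat, transpose_fromRows, fromCols_mul_fromRows, transpose_smul, Matrix.smul_mul,
      Matrix.mul_smul, smul_smul, Real.mul_self_sqrt hlam.le, hleft, hright, hU, hV,
      Matrix.mul_one, Matrix.mul_one, hD]
    simp only [diagonal_mul_diagonal, ← diagonal_smul, diagonal_add]
    rw [← diagonal_one]
    congr 1
    funext i
    have hsq := Real.sq_sqrt (hpos i).le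
    have hi := hne i
    simp only [Pi.smul_apply, smul_eq_mul]
    field_simp
    rw [hsq]
  · rw [hUhat, fromRows_mul, fromRows_mul, hA, Matrix.smul_mul, Matrix.smul_mul,
      Matrix.mul_assoc _ D, Matrix.mul_assoc V D, hDD, Matrix.mul_one, Matrix.mul_one]
end

section
/- The Moore–Penrose pseudoinverse of A_λ, given explicitly as A_λ⁺ = V D Ûᵀ where Û ∈ ℝ^{(n+d)×k} is the matrix obtained by stacking U Σ D on top of √λ·V D, has squared spectral norm ‖A_λ⁺‖² = 1/(λ + σ_k²) = 1/(λ + 1/‖A⁺‖²), where A⁺ = V Σ^{−1} Uᵀ is the Moore–Penrose pseudoinverse of A. -/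
open Matrix BigOperators

/-- The spectral (ℓ₂ operator) norm of a real matrix. -/
noncomputable def specNorm {m p : Type*} [Fintype m] [Fintype p] [DecidableEq p]
    (M : Matrix m p ℝ) : ℝ :=
  ‖LinearMap.toContinuousLinearMap (Matrix.toEuclideanLin M)‖

open scoped Matrix.Norms.L2Operator in
theorem specNorm_mul_of_transpose_mul_self {m p q : Type*} [Fintype m] [Fintype p] [Fintype q]
    [DecidableEq m] [DecidableEq p] [DecidableEq q] {V : Matrix m p ℝ} (hV : Vᵀ * V = 1)
    (M : Matrix p q ℝ) : specNorm (V * M) = specNorm M := by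
  change ‖V * M‖ = ‖M‖
  refine (mul_self_inj (norm_nonneg _) (norm_nonneg _)).1 ?_
  rw [← l2_opNorm_conjTranspose_mul_self, ← l2_opNorm_conjTranspose_mul_self]
  congr 1
  rw [conjTranspose_mul, Matrix.mul_assoc, ← Matrix.mul_assoc Vᴴ,
    conjTranspose_eq_transpose_of_trivial V, hV, Matrix.one_mul]

open scoped Matrix.Norms.L2Operator in
theorem specNorm_transpose {m p : Type*} [Fintype m] [Fintype p]
    [DecidableEq m] [DecidableEq p] (M : Matrix m p ℝ) : specNorm Mᵀ = specNorm M := by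
  change ‖Mᵀ‖ = ‖M‖
  rw [← conjTranspose_eq_transpose_of_trivial, l2_opNorm_conjTranspose]

open scoped Matrix.Norms.L2Operator in
/-- A matrix written as a singular value decomposition has the sup norm of its diagonal factor as
spectral norm. -/
theorem specNorm_mul_diagonal_mul_transpose {m p q : Type*} [Fintype m] [Fintype p] [Fintype q]
    [DecidableEq m] [DecidableEq p] [DecidableEq q] {V : Matrix m p ℝ} {W : Matrix q p ℝ}
    (hV : Vᵀ * V = 1) (hW : Wᵀ * W = 1) (a : p → ℝ) :
    specNorm (V * diagonal a * Wᵀ) = ‖a‖ := by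
  rw [Matrix.mul_assoc, specNorm_mul_of_transpose_mul_self hV, ← specNorm_transpose,
    transpose_mul, transpose_transpose, specNorm_mul_of_transpose_mul_self hW, specNorm_transpose]
  exact l2_opNorm_diagonal a

theorem Pi.norm_eq_of_nonneg_of_le {ι : Type*} [Fintype ι] {a : ι → ℝ} (i : ι)
    (h0 : ∀ j, 0 ≤ a j) (hle : ∀ j, a j ≤ a i) : ‖a‖ = a i := by
  refine le_antisymm ((pi_norm_le_iff_of_nonneg (h0 i)).2 fun j => ?_) ?_
  · rw [Real.norm_of_nonneg (h0 j)]
    exact hle j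
  · simpa only [Real.norm_of_nonneg (h0 i)] using norm_le_pi_norm a i

/-- The Moore–Penrose pseudoinverse of the augmented matrix
`A_λ`, given explicitly as `A_λ⁺ = V D Ûᵀ` with `Û` the stack of `UΣD` over
`√λ·VD`, has squared spectral norm `1/(λ + σ_k²) = 1/(λ + 1/‖A⁺‖²)`, where
`A⁺ = V Σ⁻¹ Uᵀ`. -/
theorem augmented_pseudoinverse_spectral_norm
    {n d k : ℕ} (hk : 0 < k)
    (A : Matrix (Fin n) (Fin d) ℝ) (U : Matrix (Fin n) (Fin k) ℝ)
    (V : Matrix (Fin d) (Fin k) ℝ) (σ : Fin k → ℝ)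
    (lam : ℝ) (hlam : 0 < lam)
    (hA : A = U * Matrix.diagonal σ * Vᵀ)
    (hU : Uᵀ * U = 1) (hV : Vᵀ * V = 1)
    (hσpos : ∀ i, 0 < σ i)
    (hσmono : ∀ i j : Fin k, i ≤ j → σ j ≤ σ i)
    (D : Matrix (Fin k) (Fin k) ℝ)
    (hD : D = Matrix.diagonal (fun i => (Real.sqrt ((σ i) ^ 2 + lam))⁻¹))
    (Uhat : Matrix (Fin n ⊕ Fin d) (Fin k) ℝ)
    (hUhat : Uhat = Matrix.fromRows (U * Matrix.diagonal σ * D)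
        (Real.sqrt lam • (V * D))) :
    (specNorm (V * D * Uhatᵀ)) ^ 2 = 1 / (lam + (σ ⟨k - 1, Nat.sub_lt hk Nat.one_pos⟩) ^ 2) ∧
    1 / (lam + (σ ⟨k - 1, Nat.sub_lt hk Nat.one_pos⟩) ^ 2)
      = 1 / (lam + 1 / (specNorm (V * Matrix.diagonal (fun i => (σ i)⁻¹) * Uᵀ)) ^ 2) := by
  set l : Fin k := ⟨k - 1, Nat.sub_lt hk Nat.one_pos⟩
  have hle (j : Fin k) : σ l ≤ σ j := hσmono j l (Fin.mk_le_mk.2 (Nat.le_sub_one_of_lt j.2))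
  have hpos (j : Fin k) : 0 < σ j ^ 2 + lam := by positivity
  have hUhat_orth : Uhatᵀ * Uhat = 1 := by
    have hU' (M : Matrix (Fin k) (Fin k) ℝ) : Uᵀ * (U * M) = M := by
      rw [← Matrix.mul_assoc, hU, Matrix.one_mul]
    have hV' (M : Matrix (Fin k) (Fin k) ℝ) : Vᵀ * (V * M) = M := by
      rw [← Matrix.mul_assoc, hV, Matrix.one_mul]
    rw [hUhat, transpose_fromRows, fromCols_mul_fromRows, hD]
    simp only [transpose_mul, transpose_smul, diagonal_transpose, Matrix.mul_assoc, Matrix.smul_mul,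
      Matrix.mul_smul, hU', hV', diagonal_mul_diagonal, smul_smul, Real.mul_self_sqrt hlam.le,
      ← diagonal_smul, diagonal_add, ← diagonal_one]
    refine congrArg diagonal (funext fun i => ?_)
    have hs := Real.sq_sqrt (hpos i).le
    have hne := (Real.sqrt_pos.2 (hpos i)).ne'
    simp only [Pi.smul_apply, smul_eq_mul]
    field_simp
    linarith
  constructor
  · rw [hD, specNorm_mul_diagonal_mul_transpose hV hUhat_orth,
      Pi.norm_eq_of_nonneg_of_le l (fun j => by positivity), inv_pow, Real.sq_sqrt (hpos l).le,
      one_div, add_comm]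
    intro j
    have := Real.sqrt_pos.2 (hpos l)
    have := (hσpos l).le
    gcongr
    exact hle j
  · rw [specNorm_mul_diagonal_mul_transpose hV hU,
      Pi.norm_eq_of_nonneg_of_le l (fun j => (inv_pos.2 (hσpos j)).le)
        (fun j => inv_anti₀ (hσpos l) (hle j)), inv_pow, one_div (_ ⁻¹), inv_inv]
end

section
/- Let x* = A⁺ b and ξ* = A x* − b. Suppose x̃ ∈ ℝ^d lies in the column span of Aᵀ and satisfies ‖A x̃ − b‖² ≤ (1 + ε)‖ξ*‖² for some ε ∈ (0,1). Then ‖x̃ − x*‖ ≤ 2√ε · ‖A⁺‖ · ‖ξ*‖ = (2√ε/σ_k) · ‖ξ*‖. -/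
open Matrix BigOperators

theorem Matrix.mulVec_dotProduct_mulVec_of_transpose_mul_self {R m n : Type*} [CommRing R]
    [Fintype m] [Fintype n] [DecidableEq n] {M : Matrix m n R} (hM : Mᵀ * M = 1) (v w : n → R) :
    M *ᵥ v ⬝ᵥ M *ᵥ w = v ⬝ᵥ w := by
  rw [dotProduct_mulVec, vecMul_mulVec, ← dotProduct_mulVec, hM, one_mulVec]

theorem sum_sq_eq_dotProduct_self {R ι : Type*} [CommRing R] [Fintype ι] (v : ι → R) :
    ∑ i, v i ^ 2 = v ⬝ᵥ v := by
  simp only [dotProduct, sq]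

/-- With `x* = A⁺b` and `ξ* = Ax* − b`, if `x̃` lies in the
column span of `Aᵀ` and `‖Ax̃ − b‖² ≤ (1+ε)‖ξ*‖²` for some `ε ∈ (0,1)`, then
`‖x̃ − x*‖ ≤ 2√ε·‖A⁺‖·‖ξ*‖ = (2√ε/σ_k)·‖ξ*‖`. -/
theorem prediction_error_to_solution_error
    {n d k : ℕ} (hk : 0 < k)
    (A : Matrix (Fin n) (Fin d) ℝ) (U : Matrix (Fin n) (Fin k) ℝ)
    (V : Matrix (Fin d) (Fin k) ℝ) (σ : Fin k → ℝ)
    (b : Fin n → ℝ)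
    (hA : A = U * Matrix.diagonal σ * Vᵀ)
    (hU : Uᵀ * U = 1) (hV : Vᵀ * V = 1)
    (hσpos : ∀ i, 0 < σ i)
    (hσmono : ∀ i j : Fin k, i ≤ j → σ j ≤ σ i)
    (Aplus : Matrix (Fin d) (Fin n) ℝ)
    (hAplus : Aplus = V * Matrix.diagonal (fun i => (σ i)⁻¹) * Uᵀ)
    (ε : ℝ) (hε : 0 < ε ∧ ε < 1)
    (xt : Fin d → ℝ) (hxt : ∃ z : Fin n → ℝ, xt = Aᵀ.mulVec z)
    (herr : ∑ i, ((A.mulVec xt - b) i) ^ 2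
      ≤ (1 + ε) * ∑ i, ((A.mulVec (Aplus.mulVec b) - b) i) ^ 2) :
    Real.sqrt (∑ j, ((xt - Aplus.mulVec b) j) ^ 2)
      ≤ (2 * Real.sqrt ε / σ ⟨k - 1, Nat.sub_lt hk Nat.one_pos⟩)
        * Real.sqrt (∑ i, ((A.mulVec (Aplus.mulVec b) - b) i) ^ 2) := by
  obtain ⟨z, hz⟩ := hxt
  set s := σ ⟨k - 1, Nat.sub_lt hk Nat.one_pos⟩ with hs
  have hs0 : 0 < s := hσpos _
  set r := A *ᵥ (Aplus *ᵥ b) - b with hr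
  -- The error `xt - A⁺ b` lies in the range of `V`.
  obtain ⟨y, hy⟩ : ∃ y, xt - Aplus *ᵥ b = V *ᵥ y := by
    refine ⟨diagonal σ *ᵥ (Uᵀ *ᵥ z) - diagonal (fun i => (σ i)⁻¹) *ᵥ (Uᵀ *ᵥ b), ?_⟩
    simp only [hz, hA, hAplus, mulVec_sub, mulVec_mulVec, transpose_mul, transpose_transpose,
      diagonal_transpose, Matrix.mul_assoc]
  have hσinv : diagonal σ * diagonal (fun i => (σ i)⁻¹) = 1 := by
    simp [diagonal_mul_diagonal, (hσpos _).ne']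
  have hAA : A * Aplus = U * Uᵀ := by
    calc A * Aplus
        = U * diagonal σ * (Vᵀ * V) * diagonal (fun i => (σ i)⁻¹) * Uᵀ := by
          simp only [hA, hAplus, Matrix.mul_assoc]
      _ = U * (diagonal σ * diagonal (fun i => (σ i)⁻¹)) * Uᵀ := by
          rw [hV, Matrix.mul_one, Matrix.mul_assoc U]
      _ = U * Uᵀ := by rw [hσinv, Matrix.mul_one]
  have hUr : Uᵀ *ᵥ r = 0 := by
    rw [hr, mulVec_mulVec, hAA, mulVec_sub, mulVec_mulVec, ← Matrix.mul_assoc, hU, Matrix.one_mul,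
      sub_self]
  have hres : A *ᵥ xt - b = U *ᵥ (diagonal σ *ᵥ y) + r := by
    have hAV : A * V = U * diagonal σ := by rw [hA, Matrix.mul_assoc, hV, Matrix.mul_one]
    rw [mulVec_mulVec, ← hAV, ← mulVec_mulVec, ← hy, mulVec_sub, hr]
    abel
  have horth (w : Fin k → ℝ) : U *ᵥ w ⬝ᵥ r = 0 := by
    rw [dotProduct_comm, dotProduct_mulVec, ← mulVec_transpose, hUr, zero_dotProduct]
  have hpyth : ∑ i, ((A *ᵥ xt - b) i) ^ 2 = ∑ i, (σ i * y i) ^ 2 + ∑ i, r i ^ 2 := by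
    have hdiag : ∑ i, (σ i * y i) ^ 2 = diagonal σ *ᵥ y ⬝ᵥ diagonal σ *ᵥ y := by
      rw [← sum_sq_eq_dotProduct_self]
      simp only [mulVec_diagonal]
    rw [hdiag, sum_sq_eq_dotProduct_self, sum_sq_eq_dotProduct_self, hres, add_dotProduct,
      dotProduct_add, dotProduct_add, mulVec_dotProduct_mulVec_of_transpose_mul_self hU, horth,
      dotProduct_comm r, horth]
    ring
  have hlower : s ^ 2 * ∑ i, y i ^ 2 ≤ ∑ i, (σ i * y i) ^ 2 := by
    rw [Finset.mul_sum]
    refine Finset.sum_le_sum fun i _ => ?_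
    rw [mul_pow]
    have : s ≤ σ i := hσmono _ _ (Fin.mk_le_mk.mpr (by omega) : i ≤ ⟨k - 1, _⟩)
    gcongr
  have hVy : ∑ j, ((xt - Aplus *ᵥ b) j) ^ 2 = ∑ i, y i ^ 2 := by
    rw [sum_sq_eq_dotProduct_self, sum_sq_eq_dotProduct_self, hy,
      mulVec_dotProduct_mulVec_of_transpose_mul_self hV]
  have hR : 0 ≤ ∑ i, r i ^ 2 := Finset.sum_nonneg fun i _ => sq_nonneg _
  rw [hVy]
  refine Real.sqrt_le_iff.mpr ⟨by positivity, ?_⟩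
  rw [mul_pow, div_pow, mul_pow, Real.sq_sqrt hε.1.le, Real.sq_sqrt hR, div_mul_eq_mul_div,
    le_div_iff₀ (by positivity)]
  nlinarith [mul_nonneg hε.1.le hR]
end

section
/- Let x* = A⁺ b and ξ* = A x* − b, and suppose A A⁺ b ≠ 0; set γ² = ‖b‖²/‖A A⁺ b‖². Then ‖ξ*‖² = ‖b‖² − ‖A A⁺ b‖² and ‖ξ*‖² ≤ (γ² − 1)·‖A‖²·‖x*‖². Consequently, if x̃ ∈ ℝ^d lies in the column span of Aᵀ and satisfies ‖A x̃ − b‖² ≤ (1 + ε)‖ξ*‖² for some ε ∈ (0,1), then ‖x̃ − x*‖ ≤ 2√ε · √(γ² − 1) · κ(A) · ‖x*‖, where κ(A) = σ_1/σ_k. -/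
open Matrix BigOperators

theorem sum_sq_eq_dotProduct {ι : Type*} [Fintype ι] (v : ι → ℝ) :
    ∑ i, (v i) ^ 2 = v ⬝ᵥ v := by
  simp only [dotProduct, sq]

/-- A matrix with orthonormal columns preserves the Euclidean norm. -/
theorem sum_sq_mulVec_of_transpose_mul_self {m ι : Type*} [Fintype m] [Fintype ι] [DecidableEq ι]
    (U : Matrix m ι ℝ) (hU : Uᵀ * U = 1) (y : ι → ℝ) :
    ∑ i, ((U *ᵥ y) i) ^ 2 = ∑ i, (y i) ^ 2 := by
  rw [sum_sq_eq_dotProduct, sum_sq_eq_dotProduct, dotProduct_mulVec, ← mulVec_transpose,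
    mulVec_mulVec, hU, one_mulVec]

/-- Pythagoras for the residual `U y - b` when `U` has orthonormal columns. -/
theorem sum_sq_mulVec_sub {m ι : Type*} [Fintype m] [Fintype ι] [DecidableEq ι]
    (U : Matrix m ι ℝ) (hU : Uᵀ * U = 1) (y : ι → ℝ) (b : m → ℝ) :
    ∑ i, ((U *ᵥ y - b) i) ^ 2
      = ∑ i, (y i - (Uᵀ *ᵥ b) i) ^ 2 + (∑ i, (b i) ^ 2 - ∑ i, ((Uᵀ *ᵥ b) i) ^ 2) := by
  have hcross : ∑ i, (U *ᵥ y) i * b i = ∑ i, y i * (Uᵀ *ᵥ b) i := by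
    change (U *ᵥ y) ⬝ᵥ b = y ⬝ᵥ (Uᵀ *ᵥ b)
    rw [dotProduct_mulVec, vecMul_transpose]
  have hnorm := sum_sq_mulVec_of_transpose_mul_self U hU y
  simp only [Pi.sub_apply, sub_sq, Finset.sum_add_distrib, Finset.sum_sub_distrib, mul_assoc,
    ← Finset.mul_sum]
  rw [hcross, hnorm]
  ring

/-- With `x* = A⁺b`, `ξ* = Ax* − b`, `AA⁺b ≠ 0`, and
`γ² = ‖b‖²/‖AA⁺b‖²`: `(1)` `‖ξ*‖² = ‖b‖² − ‖AA⁺b‖²`; `(2)`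
`‖ξ*‖² ≤ (γ² − 1)·‖A‖²·‖x*‖²` (with `‖A‖ = σ_1`); and `(3)` if `x̃` lies in
the column span of `Aᵀ` with `‖Ax̃ − b‖² ≤ (1+ε)‖ξ*‖²` for some `ε ∈ (0,1)`,
then `‖x̃ − x*‖ ≤ 2√ε·√(γ² − 1)·κ(A)·‖x*‖` where `κ(A) = σ_1/σ_k`. -/
theorem prediction_error_to_relative_solution_error
    {n d k : ℕ} (hk : 0 < k)
    (A : Matrix (Fin n) (Fin d) ℝ) (U : Matrix (Fin n) (Fin k) ℝ)
    (V : Matrix (Fin d) (Fin k) ℝ) (σ : Fin k → ℝ)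
    (b : Fin n → ℝ)
    (hA : A = U * Matrix.diagonal σ * Vᵀ)
    (hU : Uᵀ * U = 1) (hV : Vᵀ * V = 1)
    (hσpos : ∀ i, 0 < σ i)
    (hσmono : ∀ i j : Fin k, i ≤ j → σ j ≤ σ i)
    (Aplus : Matrix (Fin d) (Fin n) ℝ)
    (hAplus : Aplus = V * Matrix.diagonal (fun i => (σ i)⁻¹) * Uᵀ)
    (hb : A.mulVec (Aplus.mulVec b) ≠ 0)
    (gsq : ℝ)
    (hgsq : gsq = (∑ i, (b i) ^ 2) / ∑ i, ((A.mulVec (Aplus.mulVec b)) i) ^ 2) :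
    (∑ i, ((A.mulVec (Aplus.mulVec b) - b) i) ^ 2
        = (∑ i, (b i) ^ 2) - ∑ i, ((A.mulVec (Aplus.mulVec b)) i) ^ 2) ∧
    (∑ i, ((A.mulVec (Aplus.mulVec b) - b) i) ^ 2
        ≤ (gsq - 1) * (σ ⟨0, hk⟩) ^ 2 * ∑ j, ((Aplus.mulVec b) j) ^ 2) ∧
    (∀ ε : ℝ, 0 < ε → ε < 1 →
      ∀ xt : Fin d → ℝ, (∃ z : Fin n → ℝ, xt = Aᵀ.mulVec z) →
      (∑ i, ((A.mulVec xt - b) i) ^ 2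
          ≤ (1 + ε) * ∑ i, ((A.mulVec (Aplus.mulVec b) - b) i) ^ 2) →
      Real.sqrt (∑ j, ((xt - Aplus.mulVec b) j) ^ 2)
        ≤ 2 * Real.sqrt ε * Real.sqrt (gsq - 1)
          * (σ ⟨0, hk⟩ / σ ⟨k - 1, Nat.sub_lt hk Nat.one_pos⟩)
          * Real.sqrt (∑ j, ((Aplus.mulVec b) j) ^ 2)) := by
  set c : Fin k → ℝ := Uᵀ *ᵥ b with hc
  set s₁ := σ ⟨0, hk⟩ with hs₁
  set sₖ := σ ⟨k - 1, Nat.sub_lt hk Nat.one_pos⟩ with hsₖ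
  have hs₁pos : 0 < s₁ := hσpos _
  have hsₖpos : 0 < sₖ := hσpos _
  have hle : ∀ i, σ i ≤ s₁ := fun i => hσmono _ _ (Fin.mk_le_mk.mpr (Nat.zero_le _))
  have hge : ∀ i, sₖ ≤ σ i := fun i => hσmono _ _ (Fin.mk_le_mk.mpr (by omega))
  have hAV : ∀ w : Fin k → ℝ, A *ᵥ (V *ᵥ w) = U *ᵥ (fun i => σ i * w i) := by
    intro w
    rw [hA, mulVec_mulVec, Matrix.mul_assoc, hV, Matrix.mul_one, ← mulVec_mulVec]
    congr 1
    ext i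
    rw [mulVec_diagonal]
  have hx : Aplus *ᵥ b = V *ᵥ (fun i => (σ i)⁻¹ * c i) := by
    rw [hAplus, ← mulVec_mulVec, ← mulVec_mulVec]
    congr 1
    ext i
    rw [mulVec_diagonal]
  have hAx : A *ᵥ (Aplus *ᵥ b) = U *ᵥ c := by
    rw [hx, hAV]
    congr 1
    ext i
    rw [mul_inv_cancel_left₀ (hσpos i).ne']
  have hc0 : c ≠ 0 := by
    intro h
    rw [hAx, h, mulVec_zero] at hb
    exact hb rfl
  have hcpos : 0 < ∑ i, (c i) ^ 2 := by
    obtain ⟨i, hi⟩ := Function.ne_iff.mp hc0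
    exact Finset.sum_pos' (fun j _ => sq_nonneg _) ⟨i, Finset.mem_univ i, sq_pos_of_ne_zero hi⟩
  rw [hAx, sum_sq_mulVec_of_transpose_mul_self U hU] at hgsq
  have hres : ∑ i, ((U *ᵥ c - b) i) ^ 2 = ∑ i, (b i) ^ 2 - ∑ i, (c i) ^ 2 := by
    rw [sum_sq_mulVec_sub U hU, ← hc]
    simp
  have hresγ : ∑ i, ((U *ᵥ c - b) i) ^ 2 = (gsq - 1) * ∑ i, (c i) ^ 2 := by
    rw [hres, hgsq]
    field_simp
  have hγ : 0 ≤ gsq - 1 := by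
    have h0 : 0 ≤ (gsq - 1) * ∑ i, (c i) ^ 2 :=
      hresγ ▸ Finset.sum_nonneg fun i _ => sq_nonneg _
    exact nonneg_of_mul_nonneg_left h0 hcpos
  have hcle : ∑ i, (c i) ^ 2 ≤ s₁ ^ 2 * ∑ j, ((Aplus *ᵥ b) j) ^ 2 := by
    rw [hx, sum_sq_mulVec_of_transpose_mul_self V hV, Finset.mul_sum]
    refine Finset.sum_le_sum fun i _ => ?_
    calc (c i) ^ 2 = σ i ^ 2 * ((σ i)⁻¹ * c i) ^ 2 := by
          rw [← mul_pow, mul_inv_cancel_left₀ (hσpos i).ne']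
      _ ≤ s₁ ^ 2 * ((σ i)⁻¹ * c i) ^ 2 := by
          have := (hσpos i).le
          gcongr
          exact hle i
  have hbound : ∑ i, ((U *ᵥ c - b) i) ^ 2
      ≤ (gsq - 1) * s₁ ^ 2 * ∑ j, ((Aplus *ᵥ b) j) ^ 2 := by
    rw [hresγ, mul_assoc]
    exact mul_le_mul_of_nonneg_left hcle hγ
  refine ⟨?_, ?_, ?_⟩
  · rw [hAx, sum_sq_mulVec_of_transpose_mul_self U hU, hres]
  · rw [hAx]
    exact hbound
  · rintro ε hε - xt ⟨z, hz⟩ hxt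
    obtain ⟨w, hw⟩ : ∃ w, xt = V *ᵥ w := by
      refine ⟨(Matrix.diagonal σ * Uᵀ) *ᵥ z, ?_⟩
      rw [hz, hA, mulVec_mulVec]
      simp [Matrix.transpose_mul]
    rw [hAx, hw, hAV, sum_sq_mulVec_sub U hU, ← hc, ← hres] at hxt
    have hdiff : ∑ j, ((xt - Aplus *ᵥ b) j) ^ 2 = ∑ i, (w i - (σ i)⁻¹ * c i) ^ 2 := by
      rw [hw, hx, ← mulVec_sub, sum_sq_mulVec_of_transpose_mul_self V hV]
      rfl
    have hsₖle : sₖ ^ 2 * ∑ j, ((xt - Aplus *ᵥ b) j) ^ 2 ≤ ∑ i, (σ i * w i - c i) ^ 2 := by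
      rw [hdiff, Finset.mul_sum]
      refine Finset.sum_le_sum fun i _ => ?_
      calc sₖ ^ 2 * (w i - (σ i)⁻¹ * c i) ^ 2 ≤ σ i ^ 2 * (w i - (σ i)⁻¹ * c i) ^ 2 := by
            gcongr
            exact hge i
        _ = (σ i * w i - c i) ^ 2 := by
            rw [← mul_pow, mul_sub, mul_inv_cancel_left₀ (hσpos i).ne']
    set X := ∑ j, ((Aplus *ᵥ b) j) ^ 2 with hX
    have hX0 : 0 ≤ X := Finset.sum_nonneg fun i _ => sq_nonneg _
    have hmain : ∑ j, ((xt - Aplus *ᵥ b) j) ^ 2 ≤ ε * (gsq - 1) * (s₁ / sₖ) ^ 2 * X := by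
      have hεb := mul_le_mul_of_nonneg_left hbound hε.le
      have hpos : 0 < sₖ ^ 2 := by positivity
      rw [← mul_le_mul_iff_right₀ hpos]
      calc _ ≤ ε * ((gsq - 1) * s₁ ^ 2 * X) := by linarith
        _ = _ := by field_simp
    have hκ : 0 ≤ s₁ / sₖ := by positivity
    calc Real.sqrt (∑ j, ((xt - Aplus *ᵥ b) j) ^ 2)
        ≤ Real.sqrt (ε * (gsq - 1) * (s₁ / sₖ) ^ 2 * X) := Real.sqrt_le_sqrt hmain
      _ = Real.sqrt ε * Real.sqrt (gsq - 1) * (s₁ / sₖ) * Real.sqrt X := by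
          rw [Real.sqrt_mul (by positivity), Real.sqrt_mul (by positivity), Real.sqrt_mul hε.le,
            Real.sqrt_sq hκ]
      _ ≤ 2 * (Real.sqrt ε * Real.sqrt (gsq - 1) * (s₁ / sₖ) * Real.sqrt X) :=
          le_mul_of_one_le_left (by positivity) one_le_two
      _ = _ := by ring
end

section
/- Let A ∈ ℝ^{n×d}, S ∈ ℝ^{m×n}, ε ∈ (0,1), and let t ≥ 1 be an integer with t dividing d and d ≥ 2t. If for every symmetric idempotent P ∈ ℝ^{d×d} with rank(P) = t we have ‖SA(I_d − P)‖_F² ≥ (1−ε)‖A(I_d − P)‖_F², then ‖SA‖_F² ≥ (1−ε)‖A‖_F². -/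
open Matrix BigOperators

/-- Squared Frobenius norm of a real matrix. -/
noncomputable def frobSq {m p : Type*} [Fintype m] [Fintype p]
    (M : Matrix m p ℝ) : ℝ :=
  ∑ i, ∑ j, (M i j) ^ 2

/-- The orthogonal projection onto the span of the coordinate vectors of colour `b`. -/
def colourProj {ι κ : Type*} [DecidableEq ι] [DecidableEq κ] (c : ι → κ) (b : κ) :
    Matrix ι ι ℝ :=
  diagonal fun j => if c j = b then 1 else 0

theorem colourProj_transpose {ι κ : Type*} [DecidableEq ι] [DecidableEq κ]
    (c : ι → κ) (b : κ) : (colourProj c b)ᵀ = colourProj c b :=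
  diagonal_transpose _

theorem colourProj_mul_self {ι κ : Type*} [Fintype ι] [DecidableEq ι] [DecidableEq κ]
    (c : ι → κ) (b : κ) : colourProj c b * colourProj c b = colourProj c b := by
  simp [colourProj, diagonal_mul_diagonal]

theorem rank_colourProj {ι κ : Type*} [Fintype ι] [DecidableEq ι] [DecidableEq κ]
    (c : ι → κ) (b : κ) : (colourProj c b).rank = Fintype.card {j // c j = b} := by
  rw [colourProj, rank_diagonal]
  exact Fintype.card_congr (Equiv.subtypeEquivRight fun j => by simp)

theorem sum_frobSq_mul_one_sub_colourProj {μ ι κ : Type*} [Fintype μ] [Fintype ι] [Fintype κ]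
    [DecidableEq ι] [DecidableEq κ] (c : ι → κ) (M : Matrix μ ι ℝ) :
    ∑ b, frobSq (M * (1 - colourProj c b)) = (Fintype.card κ - 1) * frobSq M := by
  have entry (b : κ) (i : μ) (j : ι) :
      ((M * (1 - colourProj c b) : Matrix μ ι ℝ) i j) ^ 2 =
        M i j ^ 2 - if c j = b then M i j ^ 2 else 0 := by
    rw [Matrix.mul_sub, Matrix.mul_one, Matrix.sub_apply, colourProj, mul_diagonal]
    split_ifs <;> simp
  simp only [frobSq, entry, Finset.mul_sum]
  rw [Finset.sum_comm]
  refine Finset.sum_congr rfl fun i _ => ?_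
  rw [Finset.sum_comm]
  refine Finset.sum_congr rfl fun j _ => ?_
  simp only [Finset.sum_sub_distrib, Finset.sum_ite_eq, Finset.mem_univ, if_true,
    Finset.sum_const, Finset.card_univ, nsmul_eq_mul]
  ring

theorem card_finProdFinEquiv_symm_snd_fiber (t k : ℕ) (b : Fin k) :
    Fintype.card {j : Fin (t * k) // (finProdFinEquiv.symm j).2 = b} = t := by
  have e : {j : Fin (t * k) // (finProdFinEquiv.symm j).2 = b} ≃ Fin t :=
    (finProdFinEquiv.symm.subtypeEquiv (q := fun p : Fin t × Fin k => p.2 = b)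
      fun _ => Iff.rfl).trans
      { toFun := fun p => p.1.1
        invFun := fun a => ⟨(a, b), rfl⟩
        left_inv := by rintro ⟨⟨a, _⟩, rfl⟩; rfl
        right_inv := fun _ => rfl }
  simpa using Fintype.card_congr e

/-- If `t` divides `d`, `d ≥ 2t`, and for every rank-`t`
orthogonal projection `P` (symmetric idempotent of rank `t`) one has
`‖SA(I − P)‖_F² ≥ (1−ε)‖A(I − P)‖_F²`, then `‖SA‖_F² ≥ (1−ε)‖A‖_F²`. -/
theorem pcp_lower_bound_frobenius
    {n d m : ℕ} (t : ℕ) (ht : 1 ≤ t) (htd : t ∣ d) (hd2t : 2 * t ≤ d)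
    (ε : ℝ) (hε : 0 < ε ∧ ε < 1)
    (A : Matrix (Fin n) (Fin d) ℝ) (S : Matrix (Fin m) (Fin n) ℝ)
    (hP : ∀ P : Matrix (Fin d) (Fin d) ℝ, Pᵀ = P → P * P = P → P.rank = t →
      (1 - ε) * frobSq (A * (1 - P)) ≤ frobSq (S * A * (1 - P))) :
    (1 - ε) * frobSq A ≤ frobSq (S * A) := by
  obtain ⟨k, rfl⟩ := htd
  have hk : 2 ≤ k := Nat.le_of_mul_le_mul_left (by rwa [mul_comm t 2]) ht
  let c : Fin (t * k) → Fin k := fun j => (finProdFinEquiv.symm j).2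
  have hsum := Finset.sum_le_sum fun b (_ : b ∈ Finset.univ) =>
    hP (colourProj c b) (colourProj_transpose c b) (colourProj_mul_self c b)
      ((rank_colourProj c b).trans (card_finProdFinEquiv_symm_snd_fiber t k b))
  rw [← Finset.mul_sum, sum_frobSq_mul_one_sub_colourProj, sum_frobSq_mul_one_sub_colourProj,
    Fintype.card_fin, mul_left_comm] at hsum
  have hk' : (0 : ℝ) < k - 1 := sub_pos.2 (by exact_mod_cast hk)
  exact le_of_mul_le_mul_left hsum hk'
end

section
/- Let A ∈ ℝ^{n×d}, S ∈ ℝ^{m×n}, ε ∈ (0,1), and an integer t ≥ 1. If for every symmetric idempotent P ∈ ℝ^{d×d} with rank(P) ≤ t we have ‖SA(I_d − P)‖_F² ≤ (1+ε)‖A(I_d − P)‖_F², then the best rank-t Frobenius approximation error of SA is at most (1+ε) times that of A: there exists B' ∈ ℝ^{m×d} with rank(B') ≤ t such that for every B ∈ ℝ^{n×d} with rank(B) ≤ t, ‖SA − B'‖_F² ≤ (1+ε)·‖A − B‖_F². -/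
open Matrix BigOperators

/-- Multiplication by complementary symmetric idempotents splits the squared Frobenius norm. -/
theorem frobSq_mul_one_sub_add_frobSq_mul {m p : Type*} [Fintype m] [Fintype p] [DecidableEq p]
    (M : Matrix m p ℝ) {P : Matrix p p ℝ} (hsymm : Pᵀ = P) (hidem : P * P = P) :
    frobSq (M * (1 - P)) + frobSq (M * P) = frobSq M := by
  have key (N : Matrix m p ℝ) : frobSq N = (N * Nᵀ).trace := by
    simp [frobSq, Matrix.trace, Matrix.mul_apply, sq]
  have hP : M * P * (M * P)ᵀ = M * P * Mᵀ := by
    rw [Matrix.transpose_mul, hsymm, Matrix.mul_assoc M, ← Matrix.mul_assoc P, hidem,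
      Matrix.mul_assoc]
  have hQ : M * (1 - P) * (M * (1 - P))ᵀ = M * Mᵀ - M * P * Mᵀ := by
    have : (1 - P) * (1 - P) = 1 - P := by
      simp [Matrix.sub_mul, Matrix.mul_sub, hidem]
    rw [Matrix.transpose_mul, Matrix.transpose_sub, hsymm, Matrix.transpose_one,
      Matrix.mul_assoc M, ← Matrix.mul_assoc (1 - P), this, Matrix.sub_mul, Matrix.mul_sub,
      Matrix.one_mul, Matrix.mul_assoc]
  rw [key, key, key, hP, hQ, Matrix.trace_sub, sub_add_cancel]

theorem frobSq_nonneg {m p : Type*} [Fintype m] [Fintype p] (M : Matrix m p ℝ) :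
    0 ≤ frobSq M := by
  unfold frobSq
  positivity

theorem continuous_frobSq {m p : Type*} [Fintype m] [Fintype p] :
    Continuous (frobSq : Matrix m p ℝ → ℝ) := by
  unfold frobSq
  fun_prop

/-- The rank of a real idempotent matrix is its trace. -/
theorem Matrix.trace_eq_rank_of_mul_self_eq {p : Type*} [Fintype p] [DecidableEq p]
    {P : Matrix p p ℝ} (hidem : P * P = P) : P.trace = P.rank := by
  have h : IsIdempotentElem (Matrix.toLin' P) := by
    rw [IsIdempotentElem, Module.End.mul_eq_comp, ← Matrix.toLin'_mul, hidem]
  rw [← Matrix.trace_toLin'_eq, (LinearMap.IsIdempotentElem.isProj_range _ h).trace]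
  rfl

/-- The orthogonal projection onto the column space of a square matrix. -/
theorem Matrix.exists_symm_idempotent_mul_eq {p : Type*} [Fintype p] [DecidableEq p]
    (M : Matrix p p ℝ) :
    ∃ P : Matrix p p ℝ, Pᵀ = P ∧ P * P = P ∧ P.rank ≤ M.rank ∧ P * M = M := by
  let e := Matrix.toEuclideanCLM (n := p) (𝕜 := ℝ)
  let U : Submodule ℝ (EuclideanSpace ℝ p) := LinearMap.range (e M).toLinearMap
  have hU := isStarProjection_starProjection (U := U)
  have hrank (N : Matrix p p ℝ) : N.rank = Module.finrank ℝ (e N).range :=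
    N.rank_eq_finrank_range_toLin (EuclideanSpace.basisFun p ℝ).toBasis
      (EuclideanSpace.basisFun p ℝ).toBasis
  refine ⟨e.symm U.starProjection, ?_, ?_, ?_, ?_⟩
  · rw [← Matrix.conjTranspose_eq_transpose_of_trivial, ← Matrix.star_eq_conjTranspose]
    apply EquivLike.injective e
    rw [map_star, StarAlgEquiv.apply_symm_apply, hU.isSelfAdjoint.star_eq]
  · rw [← map_mul, hU.isIdempotentElem.eq]
  · rw [hrank, hrank, StarAlgEquiv.apply_symm_apply, Submodule.range_starProjection]
  · apply EquivLike.injective e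
    rw [map_mul, StarAlgEquiv.apply_symm_apply]
    ext1 x
    exact Submodule.starProjection_eq_self_iff.2 ⟨x, rfl⟩

/-- Some orthogonal projection of rank at most `rank B` fixes the row space of `B`. -/
theorem Matrix.exists_symm_idempotent_mul_right_eq {m p : Type*} [Fintype m] [Fintype p]
    [DecidableEq p] (B : Matrix m p ℝ) :
    ∃ P : Matrix p p ℝ, Pᵀ = P ∧ P * P = P ∧ P.rank ≤ B.rank ∧ B * P = B := by
  obtain ⟨P, hsymm, hidem, hrank, hmul⟩ := (Bᵀ * B).exists_symm_idempotent_mul_eq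
  refine ⟨P, hsymm, hidem, by rwa [Matrix.rank_transpose_mul_self] at hrank, ?_⟩
  have h : Bᵀ * B * P = Bᵀ * B := by
    simpa [hsymm] using congrArg Matrix.transpose hmul
  have h0 : Bᴴ * B * (1 - P) = 0 := by
    rw [Matrix.conjTranspose_eq_transpose_of_trivial, Matrix.mul_sub, h, Matrix.mul_one, sub_self]
  rw [Matrix.conjTranspose_mul_self_mul_eq_zero, Matrix.mul_sub, Matrix.mul_one, sub_eq_zero] at h0
  exact h0.symm

theorem Matrix.abs_apply_le_one_of_symm_idempotent {p : Type*} [Fintype p]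
    {P : Matrix p p ℝ} (hsymm : Pᵀ = P) (hidem : P * P = P) (i j : p) : |P i j| ≤ 1 := by
  have hdiag : P i i = ∑ k, P i k ^ 2 := by
    conv_lhs => rw [← hidem, Matrix.mul_apply]
    refine Finset.sum_congr rfl fun k _ => ?_
    rw [sq, ← Matrix.transpose_apply P i k, hsymm]
  have hle (k : p) : P i k ^ 2 ≤ P i i := by
    rw [hdiag]
    exact Finset.single_le_sum (f := fun k => P i k ^ 2) (fun _ _ => sq_nonneg _)
      (Finset.mem_univ k)
  rw [← sq_le_one_iff_abs_le_one]
  nlinarith [hle i, hle j]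

/-- The orthogonal projections of rank at most `t` form a compact set of matrices. -/
theorem isCompact_setOf_symm_idempotent_rank_le {p : Type*} [Fintype p] [DecidableEq p] (t : ℕ) :
    IsCompact {P : Matrix p p ℝ | Pᵀ = P ∧ P * P = P ∧ P.rank ≤ t} := by
  have heq : {P : Matrix p p ℝ | Pᵀ = P ∧ P * P = P ∧ P.rank ≤ t} =
      {P | Pᵀ = P} ∩ ({P | P * P = P} ∩ {P | P.trace ≤ (t : ℝ)}) := by
    ext P
    simp only [Set.mem_ofPred_eq, Set.mem_inter_iff]
    refine and_congr_right fun _ => and_congr_right fun hidem => ?_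
    rw [Matrix.trace_eq_rank_of_mul_self_eq hidem, Nat.cast_le]
  have hclosed : IsClosed {P : Matrix p p ℝ | Pᵀ = P ∧ P * P = P ∧ P.rank ≤ t} := by
    rw [heq]
    exact (isClosed_eq (by fun_prop) (by fun_prop)).inter
      ((isClosed_eq (by fun_prop) (by fun_prop)).inter (isClosed_le (by fun_prop) (by fun_prop)))
  have hbox : IsCompact (Set.univ.pi fun _ : p => Set.univ.pi fun _ : p => Set.Icc (-1 : ℝ) 1) :=
    isCompact_univ_pi fun _ => isCompact_univ_pi fun _ => isCompact_Icc
  refine hbox.of_isClosed_subset hclosed fun P hP i _ j _ => ?_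
  exact abs_le.1 (Matrix.abs_apply_le_one_of_symm_idempotent hP.1 hP.2.1 i j)

/-- If for every symmetric idempotent `P` of rank at most `t`
one has `‖SA(I − P)‖_F² ≤ (1+ε)‖A(I − P)‖_F²`, then the best rank-`t`
Frobenius approximation error of `SA` is at most `(1+ε)` times that of `A`:
there is `B'` of rank at most `t` with
`‖SA − B'‖_F² ≤ (1+ε)‖A − B‖_F²` for every `B` of rank at most `t`. -/
theorem pcp_best_rank_t_error
    {n d m : ℕ} (t : ℕ) (ht : 1 ≤ t) (ε : ℝ) (hε : 0 < ε ∧ ε < 1)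
    (A : Matrix (Fin n) (Fin d) ℝ) (S : Matrix (Fin m) (Fin n) ℝ)
    (hP : ∀ P : Matrix (Fin d) (Fin d) ℝ, Pᵀ = P → P * P = P → P.rank ≤ t →
      frobSq (S * A * (1 - P)) ≤ (1 + ε) * frobSq (A * (1 - P))) :
    ∃ B' : Matrix (Fin m) (Fin d) ℝ, B'.rank ≤ t ∧
      ∀ B : Matrix (Fin n) (Fin d) ℝ, B.rank ≤ t →
        frobSq (S * A - B') ≤ (1 + ε) * frobSq (A - B) := by
  obtain ⟨P, hPmem, hmin⟩ := (isCompact_setOf_symm_idempotent_rank_le (p := Fin d) t).exists_isMinOn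
    ⟨0, by simp⟩ (f := fun P => frobSq (S * A * (1 - P)))
    (continuous_frobSq.comp (by fun_prop)).continuousOn
  refine ⟨S * A * P, (Matrix.rank_mul_le_right _ _).trans hPmem.2.2, fun B hB => ?_⟩
  obtain ⟨Q, hsymm, hidem, hrank, hmul⟩ := B.exists_symm_idempotent_mul_right_eq
  have hBQ : (A - B) * (1 - Q) = A * (1 - Q) := by
    rw [Matrix.sub_mul, Matrix.mul_sub B, hmul, Matrix.mul_one, sub_self, sub_zero]
  have hsplit := frobSq_mul_one_sub_add_frobSq_mul (A - B) hsymm hidem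
  rw [hBQ] at hsplit
  calc frobSq (S * A - S * A * P) = frobSq (S * A * (1 - P)) := by
        rw [Matrix.mul_sub, Matrix.mul_one]
    _ ≤ frobSq (S * A * (1 - Q)) := hmin ⟨hsymm, hidem, hrank.trans hB⟩
    _ ≤ (1 + ε) * frobSq (A * (1 - Q)) := hP Q hsymm hidem (hrank.trans hB)
    _ ≤ (1 + ε) * frobSq (A - B) := by
        refine mul_le_mul_of_nonneg_left ?_ (by linarith [hε.1])
        linarith [frobSq_nonneg ((A - B) * Q)]
end

section
/- Let A ∈ ℝ^{n×d}, S ∈ ℝ^{m×n}, and ε ∈ (0,1), and suppose that for every x ∈ ℝ^d, (1−ε)‖Ax‖ ≤ ‖SAx‖ ≤ (1+ε)‖Ax‖. Suppose further SA = QC where Q ∈ ℝ^{m×d} has orthonormal columns (QᵀQ = I_d) and C ∈ ℝ^{d×d} is invertible. Then for every x ∈ ℝ^d, ‖x‖/(1+ε) ≤ ‖A C^{−1} x‖ ≤ ‖x‖/(1−ε); i.e., all singular values of A C^{−1} lie in the interval [1/(1+ε), 1/(1−ε)]. -/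
open Matrix BigOperators

/-- A real matrix with orthonormal columns preserves the sum of squares of a vector. -/
theorem sum_mulVec_sq_of_transpose_mul_self_eq_one {m d : Type*} [Fintype m] [Fintype d]
    [DecidableEq d] {Q : Matrix m d ℝ} (hQ : Qᵀ * Q = 1) (x : d → ℝ) :
    ∑ i, ((Q.mulVec x) i) ^ 2 = ∑ j, (x j) ^ 2 := by
  have h : Q *ᵥ x ⬝ᵥ Q *ᵥ x = x ⬝ᵥ x := by
    rw [dotProduct_mulVec, ← mulVec_transpose, mulVec_mulVec, hQ, one_mulVec]
  simpa only [dotProduct, ← sq] using h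

/-- If `(1−ε)‖Ax‖ ≤ ‖SAx‖ ≤ (1+ε)‖Ax‖` for every `x`, and
`SA = QC` with `Q` having orthonormal columns and `C` invertible, then for
every `x`, `‖x‖/(1+ε) ≤ ‖AC⁻¹x‖ ≤ ‖x‖/(1−ε)`; i.e. all singular values of
`AC⁻¹` lie in `[1/(1+ε), 1/(1−ε)]`. -/
theorem qr_whitening_well_conditioned
    {n d m : ℕ} (ε : ℝ) (hε : 0 < ε ∧ ε < 1)
    (A : Matrix (Fin n) (Fin d) ℝ) (S : Matrix (Fin m) (Fin n) ℝ)
    (Q : Matrix (Fin m) (Fin d) ℝ) (C : Matrix (Fin d) (Fin d) ℝ)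
    (hemb : ∀ x : Fin d → ℝ,
      (1 - ε) * Real.sqrt (∑ i, ((A.mulVec x) i) ^ 2)
        ≤ Real.sqrt (∑ i, (((S * A).mulVec x) i) ^ 2) ∧
      Real.sqrt (∑ i, (((S * A).mulVec x) i) ^ 2)
        ≤ (1 + ε) * Real.sqrt (∑ i, ((A.mulVec x) i) ^ 2))
    (hQR : S * A = Q * C)
    (hQ : Qᵀ * Q = 1)
    (hC : IsUnit C.det) :
    ∀ x : Fin d → ℝ,
      Real.sqrt (∑ j, (x j) ^ 2) / (1 + ε)
        ≤ Real.sqrt (∑ i, (((A * C⁻¹).mulVec x) i) ^ 2) ∧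
      Real.sqrt (∑ i, (((A * C⁻¹).mulVec x) i) ^ 2)
        ≤ Real.sqrt (∑ j, (x j) ^ 2) / (1 - ε) := by
  intro x
  have hSA : (S * A) *ᵥ (C⁻¹ *ᵥ x) = Q *ᵥ x := by
    rw [mulVec_mulVec, hQR, Matrix.mul_assoc, mul_nonsing_inv C hC, Matrix.mul_one]
  obtain ⟨hlower, hupper⟩ := hemb (C⁻¹ *ᵥ x)
  rw [hSA, sum_mulVec_sq_of_transpose_mul_self_eq_one hQ, mulVec_mulVec] at hlower hupper
  constructor
  · rwa [div_le_iff₀' (by linarith)]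
  · rwa [le_div_iff₀' (by linarith)]
end

section
/- Let Â ∈ ℝ^{n×m} be a nonzero matrix with largest singular value σ_max and smallest nonzero singular value σ_min, and let v ∈ ℝ^m lie in the column span of Âᵀ (the row space of Â). Then for every row index i ∈ {1,…,n}: (Â_{i,*} · v)² · (Σ_{j=1}^m ‖Â_{*,j}‖² v_j²) ≤ m · (σ_max²/σ_min²) · ‖Â v‖² · (Σ_{j=1}^m Â_{ij}² v_j²). In particular, the rejection-sampling acceptance ratio q_i/p_i, where q_i = (Â_{i,*}v)²/‖Âv‖² and p_i = (Σ_j Â_{ij}² v_j²)/(Σ_j ‖Â_{*,j}‖² v_j²), is at most m·κ(Â)² whenever these ratios are defined. -/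
open Matrix BigOperators

/-- A Euclidean bound `‖A u‖ ≤ σ ‖u‖` bounds the squared norm of every column by `σ ^ 2`. -/
theorem sum_sq_col_le_sq {n m : ℕ} (A : Matrix (Fin n) (Fin m) ℝ) (σ : ℝ)
    (h : ∀ u : Fin m → ℝ,
      Real.sqrt (∑ i, ((A.mulVec u) i) ^ 2) ≤ σ * Real.sqrt (∑ j, (u j) ^ 2))
    (j : Fin m) : ∑ i, (A i j) ^ 2 ≤ σ ^ 2 := by
  have hj := h (Pi.single j 1)
  have hone : ∑ k, (Pi.single j (1 : ℝ) : Fin m → ℝ) k ^ 2 = 1 := by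
    simp [Pi.single_apply]
  rw [hone] at hj
  simp only [Matrix.mulVec_single_one, Matrix.col_apply, Real.sqrt_one, mul_one] at hj
  exact (Real.sqrt_le_left ((Real.sqrt_nonneg _).trans hj)).mp hj

/-- Let `Â` be a nonzero `n × m` real matrix, `σmax` its
largest singular value (so `‖Âv‖ ≤ σmax‖v‖` for all `v`) and `σmin > 0` its
smallest nonzero singular value (so `σmin‖v‖ ≤ ‖Âv‖` for all `v` in the row
space of `Â`, and `‖Â_{*,j}‖ ≤ σmax` for all `j`). Then for `v = Âᵀw` in the
row space and every row `i`:
`(Â_{i,*}·v)²·(Σ_j ‖Â_{*,j}‖² v_j²) ≤ m·(σmax²/σmin²)·‖Âv‖²·(Σ_j Â_{ij}² v_j²)`.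
In particular, the rejection-sampling ratio `q_i/p_i`, with
`q_i = (Â_{i,*}v)²/‖Âv‖²` and `p_i = (Σ_j Â_{ij}²v_j²)/(Σ_j ‖Â_{*,j}‖²v_j²)`,
is at most `m·κ(Â)² = m·(σmax/σmin)²` whenever these ratios are defined. -/
theorem rejection_sampling_ratio_bound
    {n m : ℕ} (Ah : Matrix (Fin n) (Fin m) ℝ) (hAh : Ah ≠ 0)
    (σmax σmin : ℝ) (hσmin : 0 < σmin)
    (hmax : ∀ u : Fin m → ℝ,
      Real.sqrt (∑ i, ((Ah.mulVec u) i) ^ 2) ≤ σmax * Real.sqrt (∑ j, (u j) ^ 2))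
    (hmin : ∀ w : Fin n → ℝ,
      σmin * Real.sqrt (∑ j, ((Ahᵀ.mulVec w) j) ^ 2)
        ≤ Real.sqrt (∑ i, ((Ah.mulVec (Ahᵀ.mulVec w)) i) ^ 2))
    (v : Fin m → ℝ) (hv : ∃ w : Fin n → ℝ, v = Ahᵀ.mulVec w) :
    ∀ i : Fin n,
      ((∑ j, Ah i j * v j) ^ 2) * (∑ j, (∑ i', (Ah i' j) ^ 2) * (v j) ^ 2)
        ≤ (m : ℝ) * (σmax ^ 2 / σmin ^ 2)
          * (∑ i', ((Ah.mulVec v) i') ^ 2) * (∑ j, (Ah i j) ^ 2 * (v j) ^ 2) ∧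
      ((∑ i', ((Ah.mulVec v) i') ^ 2) ≠ 0 → (∑ j, (Ah i j) ^ 2 * (v j) ^ 2) ≠ 0 →
        (((∑ j, Ah i j * v j) ^ 2) / (∑ i', ((Ah.mulVec v) i') ^ 2))
            / ((∑ j, (Ah i j) ^ 2 * (v j) ^ 2) / (∑ j, (∑ i', (Ah i' j) ^ 2) * (v j) ^ 2))
          ≤ (m : ℝ) * (σmax / σmin) ^ 2) := by
  obtain ⟨w, rfl⟩ := hv
  intro i
  set v := Ahᵀ.mulVec w
  set C := ∑ j, (∑ i', (Ah i' j) ^ 2) * (v j) ^ 2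
  set N := ∑ i', ((Ah.mulVec v) i') ^ 2
  set P := ∑ j, (Ah i j) ^ 2 * (v j) ^ 2
  have hP : 0 ≤ P := by positivity
  have hN : 0 ≤ N := by positivity
  have hC : 0 ≤ C := by positivity
  have hrow : (∑ j, Ah i j * v j) ^ 2 ≤ m * P := by
    simpa [mul_pow, P] using
      sq_sum_le_card_mul_sum_sq (s := Finset.univ) (f := fun j => Ah i j * v j)
  have hcol : C ≤ σmax ^ 2 * ∑ j, (v j) ^ 2 := by
    rw [Finset.mul_sum]
    exact Finset.sum_le_sum fun j _ =>
      mul_le_mul_of_nonneg_right (sum_sq_col_le_sq Ah σmax hmax j) (sq_nonneg _)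
  have hv : σmin ^ 2 * ∑ j, (v j) ^ 2 ≤ N := by
    have h := pow_le_pow_left₀ (by positivity) (hmin w) 2
    rwa [mul_pow, Real.sq_sqrt (by positivity), Real.sq_sqrt (by positivity)] at h
  have hCN : C ≤ σmax ^ 2 / σmin ^ 2 * N := by
    calc C ≤ σmax ^ 2 * ∑ j, (v j) ^ 2 := hcol
      _ = σmax ^ 2 / σmin ^ 2 * (σmin ^ 2 * ∑ j, (v j) ^ 2) := by field_simp
      _ ≤ σmax ^ 2 / σmin ^ 2 * N := by gcongr
  have hmain : (∑ j, Ah i j * v j) ^ 2 * C ≤ m * (σmax ^ 2 / σmin ^ 2) * N * P := by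
    calc (∑ j, Ah i j * v j) ^ 2 * C ≤ (m * P) * (σmax ^ 2 / σmin ^ 2 * N) := by gcongr
      _ = m * (σmax ^ 2 / σmin ^ 2) * N * P := by ring
  refine ⟨hmain, fun hN0 hP0 => ?_⟩
  rw [div_div_div_eq, div_pow, div_le_iff₀ (by positivity), ← mul_assoc]
  exact hmain
end
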